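/- (Lemma 4, general safe set bound) Let ε ∈ (0,1), f : ℝ^n → ℝ^n, g : ℝ^n → ℝ^{n×m}, and let Σ_w ∈ ℝ^{n×n} be symmetric positive definite. Let h : ℝ^n → ℝ be twice continuously differentiable and suppose there is σ ≥ 0 with −σ I ⪯ ∇²h(y) for all y ∈ ℝ^n. Fix x ∈ ℝ^n and u ∈ ℝ^m, define w̄ ∈ ℝ^n by w̄_i = WCVaR_ε[w ↦ w_i] (over 𝒫(Σ_w)), assumed finite for each i, and set x̄⁺ = f(x) + g(x)u + w̄. Then WCVaR_ε[w ↦ −h(f(x) + g(x)u + w)] ≤ −h(x̄⁺) + WCVaR_ε[w ↦ −∇h(x̄⁺)ᵀ(w − w̄) + (σ/2)·‖w − w̄‖²], with the inequality interpreted in the extended reals. -/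

import Mathlib

open MeasureTheory RealInnerProductSpace

/-- Conditional value-at-risk of a loss at level ε with respect to P. -/
noncomputable def CVaR {n : ℕ} (ε : ℝ) (P : Measure (EuclideanSpace ℝ (Fin n)))
    (L : EuclideanSpace ℝ (Fin n) → ℝ) : ℝ :=
  ⨅ β : ℝ, (β + (1 / ε) * ∫ w, max (L w - β) 0 ∂P)

/-- The set of Borel probability measures on ℝ^n with finite second moments,
zero mean, and second-moment matrix Σ. -/
def Pset (n : ℕ) (S : Matrix (Fin n) (Fin n) ℝ) :
    Set (Measure (EuclideanSpace ℝ (Fin n))) :=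
  {P | IsProbabilityMeasure P ∧ Integrable (fun w => ‖w‖ ^ 2) P ∧
    (∀ i, ∫ w, w i ∂P = 0) ∧ ∀ i j, ∫ w, w i * w j ∂P = S i j}

/-- Worst-case CVaR over the moment set, valued in the extended reals. -/
noncomputable def WCVaR {n : ℕ} (ε : ℝ) (S : Matrix (Fin n) (Fin n) ℝ)
    (L : EuclideanSpace ℝ (Fin n) → ℝ) : EReal :=
  ⨆ P ∈ Pset n S, ((CVaR ε P L : ℝ) : EReal)

/-- A function whose Hessian is bounded below by `-σ` lies above its first-order expansion minus
the quadratic `σ / 2 * ‖·‖ ^ 2`. -/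
theorem add_fderiv_sub_sq_le_of_hessian_ge {E : Type*} [NormedAddCommGroup E] [NormedSpace ℝ E]
    {h : E → ℝ} (hh : ContDiff ℝ 2 h) {σ : ℝ}
    (hHess : ∀ c z : E, -σ * ‖z‖ ^ 2 ≤ iteratedFDeriv ℝ 2 h c ![z, z]) (a v : E) :
    h a + fderiv ℝ h a v - σ / 2 * ‖v‖ ^ 2 ≤ h (a + v) := by
  have hd : Differentiable ℝ h := hh.differentiable (by norm_num)
  have hd' : Differentiable ℝ (fderiv ℝ h) :=
    (hh.fderiv_right (m := 1) (by norm_num)).differentiable (by norm_num)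
  have hline (t : ℝ) : HasDerivAt (fun t : ℝ => a + t • v) v t := by
    simpa using ((hasDerivAt_id t).smul_const v).const_add a
  have hφ (t : ℝ) : HasDerivAt (fun t : ℝ => h (a + t • v) + σ / 2 * ‖v‖ ^ 2 * t ^ 2)
      (fderiv ℝ h (a + t • v) v + σ * ‖v‖ ^ 2 * t) t := by
    have h1 := (hd (a + t • v)).hasFDerivAt.comp_hasDerivAt t (hline t)
    have h2 := (hasDerivAt_pow 2 t).const_mul (σ / 2 * ‖v‖ ^ 2)
    exact (h1.add h2).congr_deriv (by push_cast; ring)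
  have hφ' (t : ℝ) : HasDerivAt (fun t : ℝ => fderiv ℝ h (a + t • v) v + σ * ‖v‖ ^ 2 * t)
      (fderiv ℝ (fderiv ℝ h) (a + t • v) v v + σ * ‖v‖ ^ 2) t := by
    have h1 := (hd' (a + t • v)).hasFDerivAt.comp_hasDerivAt t (hline t)
    have h2 := h1.clm_apply (hasDerivAt_const t v)
    have h3 := (hasDerivAt_id t).const_mul (σ * ‖v‖ ^ 2)
    exact (h2.add h3).congr_deriv (by simp)
  have hmono : Monotone (fun t : ℝ => fderiv ℝ h (a + t • v) v + σ * ‖v‖ ^ 2 * t) := by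
    refine monotone_of_deriv_nonneg (fun t => (hφ' t).differentiableAt) fun t => ?_
    have := hHess (a + t • v) v
    rw [iteratedFDeriv_two_apply] at this
    rw [(hφ' t).deriv]
    simp at this
    linarith
  obtain ⟨ξ, hξ, hslope⟩ := exists_hasDerivAt_eq_slope _ _ (zero_lt_one' ℝ)
    (fun t _ => (hφ t).continuousAt.continuousWithinAt) (fun t _ => hφ t)
  have := hmono hξ.1.le
  simp only [hslope] at this
  simp at this
  linarith

/-- For a loss with integrable positive parts, the objective defining `CVaR` is bounded below. -/
theorem bddBelow_range_CVaR_objective {α : Type*} [MeasurableSpace α] {P : Measure α}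
    [IsProbabilityMeasure P] {ε : ℝ} (hε : ε ∈ Set.Ioo (0 : ℝ) 1) {L : α → ℝ} (hL : Measurable L)
    (hint : ∀ β : ℝ, Integrable (fun w => max (L w - β) 0) P) :
    BddBelow (Set.range fun β : ℝ => β + (1 / ε) * ∫ w, max (L w - β) 0 ∂P) := by
  obtain ⟨hε0, hε1⟩ := hε
  obtain ⟨M, hM⟩ : ∃ M : ℕ, ε < P.real {w | -(M : ℝ) ≤ L w} := by
    have hmono : Monotone fun M : ℕ => {w | -(M : ℝ) ≤ L w} := by
      intro M N hMN w hw
      have : (M : ℝ) ≤ N := by exact_mod_cast hMN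
      simp only [Set.mem_ofPred_eq] at hw ⊢
      linarith
    have hU : (⋃ M : ℕ, {w | -(M : ℝ) ≤ L w}) = Set.univ := by
      refine Set.eq_univ_of_forall fun w => Set.mem_iUnion.2 ?_
      obtain ⟨M, hM⟩ := exists_nat_ge (-L w)
      exact ⟨M, by simp only [Set.mem_ofPred_eq]; linarith⟩
    have ht := tendsto_measure_iUnion_atTop (μ := P) hmono
    rw [hU, measure_univ] at ht
    have ht' := (ENNReal.tendsto_toReal ENNReal.one_ne_top).comp ht
    exact (ht'.eventually (lt_mem_nhds (by simpa using hε1))).exists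
  set δ := P.real {w | -(M : ℝ) ≤ L w} with hδ
  have hs : MeasurableSet {w | -(M : ℝ) ≤ L w} := measurableSet_le measurable_const hL
  refine ⟨-(δ / ε * M), ?_⟩
  rintro _ ⟨β, rfl⟩
  have hδε : 1 < δ / ε := (one_lt_div hε0).2 hM
  have hM0 : (0 : ℝ) ≤ M := M.cast_nonneg
  have hI0 : 0 ≤ ∫ w, max (L w - β) 0 ∂P := integral_nonneg fun w => le_max_right _ _
  rcases le_total 0 β with hβ | hβ
  · have : 0 ≤ (1 / ε) * ∫ w, max (L w - β) 0 ∂P := by positivity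
    have : 0 ≤ δ / ε * M := by positivity
    dsimp only
    linarith
  · have hI : δ * (-M - β) ≤ ∫ w, max (L w - β) 0 ∂P := by
      calc δ * (-M - β) = ∫ w in {w | -(M : ℝ) ≤ L w}, (-(M : ℝ) - β) ∂P := by
            rw [setIntegral_const, smul_eq_mul]
        _ ≤ ∫ w in {w | -(M : ℝ) ≤ L w}, max (L w - β) 0 ∂P := by
            refine setIntegral_mono_on (integrable_const _) (hint β).integrableOn hs ?_
            intro w hw
            simp only [Set.mem_ofPred_eq] at hw
            exact le_max_of_le_left (by linarith)
        _ ≤ ∫ w, max (L w - β) 0 ∂P :=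
            setIntegral_le_integral (hint β) (ae_of_all _ fun w => le_max_right _ _)
    have h1 : (1 / ε) * (δ * (-M - β)) ≤ (1 / ε) * ∫ w, max (L w - β) 0 ∂P :=
      mul_le_mul_of_nonneg_left hI (by positivity)
    have h2 : (1 / ε) * (δ * (-M - β)) = -(δ / ε * M) - δ / ε * β := by ring
    dsimp only
    nlinarith

/-- Monotonicity of `CVaR` up to a constant shift, for an integrable dominating loss. -/
theorem CVaR_le_const_add_CVaR {n : ℕ} {ε : ℝ} (hε : ε ∈ Set.Ioo (0 : ℝ) 1)
    {P : Measure (EuclideanSpace ℝ (Fin n))} [IsProbabilityMeasure P]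
    {L₁ L₂ : EuclideanSpace ℝ (Fin n) → ℝ} {c : ℝ} (hL₁ : Measurable L₁) (hL₂ : Integrable L₂ P)
    (hle : ∀ w, L₁ w ≤ c + L₂ w) :
    CVaR ε P L₁ ≤ c + CVaR ε P L₂ := by
  have hint₂ (β : ℝ) : Integrable (fun w => max (L₂ w - β) 0) P :=
    (hL₂.sub (integrable_const β)).pos_part
  have hcmp (β : ℝ) (w) : max (L₁ w - (c + β)) 0 ≤ max (L₂ w - β) 0 :=
    max_le_max_right _ (by linarith [hle w])
  have hint₁ (β : ℝ) : Integrable (fun w => max (L₁ w - β) 0) P := by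
    refine (hint₂ (β - c)).mono' (by fun_prop) (ae_of_all _ fun w => ?_)
    rw [Real.norm_of_nonneg (le_max_right _ _)]
    simpa using hcmp (β - c) w
  rw [← sub_le_iff_le_add']
  refine le_ciInf fun β => ?_
  have h1 : CVaR ε P L₁ ≤ (c + β) + (1 / ε) * ∫ w, max (L₁ w - (c + β)) 0 ∂P :=
    ciInf_le (bddBelow_range_CVaR_objective hε hL₁ hint₁) (c + β)
  have h2 : (1 / ε) * ∫ w, max (L₁ w - (c + β)) 0 ∂P ≤ (1 / ε) * ∫ w, max (L₂ w - β) 0 ∂P :=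
    mul_le_mul_of_nonneg_left (integral_mono (hint₁ _) (hint₂ β) (hcmp β))
      (one_div_nonneg.2 hε.1.le)
  linarith

/-- (Lemma 4, general safe set bound) For a C² barrier function h whose Hessian is
bounded below by −σI, the worst-case CVaR of −h(x⁺) is bounded by the value at the
worst-case-CVaR-shifted point plus a quadratic correction term. -/
theorem general_safe_set_bound {n m : ℕ} (ε : ℝ) (hε : ε ∈ Set.Ioo (0 : ℝ) 1)
    (f : EuclideanSpace ℝ (Fin n) → EuclideanSpace ℝ (Fin n))
    (g : EuclideanSpace ℝ (Fin n) → Matrix (Fin n) (Fin m) ℝ)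
    (Sw : Matrix (Fin n) (Fin n) ℝ) (hSw : Sw.PosDef)
    (h : EuclideanSpace ℝ (Fin n) → ℝ) (hh : ContDiff ℝ 2 h)
    (σ : ℝ) (hσ : 0 ≤ σ)
    (hHess : ∀ c z : EuclideanSpace ℝ (Fin n),
      -σ * ‖z‖ ^ 2 ≤ iteratedFDeriv ℝ 2 h c ![z, z])
    (x : EuclideanSpace ℝ (Fin n)) (u : Fin m → ℝ)
    (wbar : EuclideanSpace ℝ (Fin n))
    (hwbar : ∀ i, WCVaR ε Sw (fun w => w i) = ((wbar i : ℝ) : EReal)) :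
    WCVaR ε Sw
        (fun w => -h (f x + (EuclideanSpace.equiv (Fin n) ℝ).symm ((g x).mulVec u) + w)) ≤
      ((-h (f x + (EuclideanSpace.equiv (Fin n) ℝ).symm ((g x).mulVec u) + wbar) : ℝ) : EReal) +
        WCVaR ε Sw (fun w =>
          -⟪gradient h (f x + (EuclideanSpace.equiv (Fin n) ℝ).symm ((g x).mulVec u) + wbar),
              w - wbar⟫ + σ / 2 * ‖w - wbar‖ ^ 2) := by
  refine iSup₂_le fun P hP => ?_
  have := hP.1
  have hL2 : MemLp (fun w : EuclideanSpace ℝ (Fin n) => w - wbar) 2 P :=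
    ((memLp_two_iff_integrable_sq_norm aestronglyMeasurable_id).2 hP.2.1).sub (memLp_const wbar)
  set y := f x + (EuclideanSpace.equiv (Fin n) ℝ).symm ((g x).mulVec u)
  have hint : Integrable (fun w => -⟪gradient h (y + wbar), w - wbar⟫ +
      σ / 2 * ‖w - wbar‖ ^ 2) P :=
    ((hL2.integrable one_le_two).const_inner _).neg.add (hL2.norm.integrable_sq.const_mul _)
  have hmeas : Measurable fun w => -h (y + w) := by
    have := hh.continuous
    exact Continuous.measurable (by fun_prop)
  have hbound (w : EuclideanSpace ℝ (Fin n)) : -h (y + w) ≤ -h (y + wbar) +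
      (-⟪gradient h (y + wbar), w - wbar⟫ + σ / 2 * ‖w - wbar‖ ^ 2) := by
    have := add_fderiv_sub_sq_le_of_hessian_ge hh hHess (y + wbar) (w - wbar)
    rw [show y + wbar + (w - wbar) = y + w by abel] at this
    rw [gradient, InnerProductSpace.toDual_symm_apply]
    linarith
  calc ((CVaR ε P fun w => -h (y + w) : ℝ) : EReal)
      ≤ ((-h (y + wbar) + CVaR ε P (fun w => -⟪gradient h (y + wbar), w - wbar⟫ +
          σ / 2 * ‖w - wbar‖ ^ 2) : ℝ) : EReal) :=
        EReal.coe_le_coe_iff.2 (CVaR_le_const_add_CVaR hε hmeas hint hbound)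
    _ ≤ _ := by
        rw [EReal.coe_add]
        gcongr
        exact le_iSup₂ (f := fun P _ => ((CVaR ε P _ : ℝ) : EReal)) P hP
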